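/- arXiv:1407.4288 — 2 statements merged into one kernel-verified Lean document; each statement's English description precedes it below -/
import Mathlib

section
/- Let α ≤ β be antichains of subsets of a finite set N, and associate to the interval [α,β] the graph G_{[α,β]} with vertex set β and an edge between A, B ∈ β iff {A ∩ B} ≰ α. Suppose β = ν₁ ∪ ν₂ where no edge of G_{[α,β]} joins an element of ν₁ to an element of ν₂. Then [α,β] = [α, α ∨ ν₁] ∨ [α, α ∨ ν₂] = [α ∧ ν₁, ν₁] ∨ [α ∧ ν₂, ν₂], and both joins of intervals are direct (each antichain in [α,β] is the join of a unique pair from the two factor intervals). -/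
/-!
Antichains of subsets of a finite universe
(following De Causmaecker & De Wannemacker,
"On the number of antichains of sets in a finite universe").
-/

open scoped Classical

namespace Antichains

variable {V : Type*} [DecidableEq V]

/-- The `max` operator: keep only the non-dominated members of a family of sets. -/
def maxl (S : Finset (Finset V)) : Finset (Finset V) :=
  S.filter fun X => ∀ Y ∈ S, ¬X ⊂ Y

/-- `A` is an antichain of subsets: no two members are in a subset-superset relation. -/
def IsAC (A : Finset (Finset V)) : Prop :=
  ∀ X ∈ A, ∀ Y ∈ A, X ⊆ Y → X = Y

/-- The domination (partial) order on antichains: `acle A B` iff every member of `A`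
is contained in some member of `B`. -/
def acle (A B : Finset (Finset V)) : Prop :=
  ∀ X ∈ A, ∃ Y ∈ B, X ⊆ Y

/-- Strict domination. -/
def aclt (A B : Finset (Finset V)) : Prop :=
  acle A B ∧ ¬acle B A

/-- Join of antichains: `A ∨ B = max (A ∪ B)`. -/
def acjoin (A B : Finset (Finset V)) : Finset (Finset V) :=
  maxl (A ∪ B)

/-- Meet of antichains: `A ∧ B = max {X ∩ Y | X ∈ A, Y ∈ B}`. -/
def acmeet (A B : Finset (Finset V)) : Finset (Finset V) :=
  maxl ((A ×ˢ B).image fun p => p.1 ∩ p.2)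

/-- `X⁻`: the antichain of immediate subsets of `X`. -/
def im (X : Finset V) : Finset (Finset V) :=
  X.image fun x => X.erase x

/-- The interval poset `P_[a,b] = {X | a ∨ {X} ∈ (a,b]}`. -/
noncomputable def iposet [Fintype V] (a b : Finset (Finset V)) : Finset (Finset V) :=
  Finset.univ.filter fun X : Finset V => aclt a (acjoin a {X}) ∧ acle (acjoin a {X}) b

/-- `χ` belongs, as an antichain, to the interval `[a,b]`. -/
def memI (a b χ : Finset (Finset V)) : Prop :=
  IsAC χ ∧ acle a χ ∧ acle χ b

/-- `X` lies in the down-set generated by the family `A`. -/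
def Below (A : Finset (Finset V)) (X : Finset V) : Prop :=
  ∃ Y ∈ A, X ⊆ Y

theorem acle_iff {V : Type*} {A B : Finset (Finset V)} : acle A B ↔ ∀ X, Below A X → Below B X := by
  refine ⟨?_, fun h X hX => h X ⟨X, hX, subset_rfl⟩⟩
  rintro h X ⟨Y, hY, hXY⟩
  obtain ⟨Z, hZ, hYZ⟩ := h Y hY
  exact ⟨Z, hZ, hXY.trans hYZ⟩

theorem below_maxl {S : Finset (Finset V)} {X : Finset V} : Below (maxl S) X ↔ Below S X := by
  constructor
  · rintro ⟨Y, hY, hXY⟩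
    exact ⟨Y, (Finset.mem_filter.1 hY).1, hXY⟩
  · rintro ⟨Y, hY, hXY⟩
    obtain ⟨Z, hYZ, hZ⟩ := S.exists_le_maximal hY
    exact ⟨Z, Finset.mem_filter.2 ⟨hZ.prop, fun W hW => hZ.not_gt hW⟩, hXY.trans hYZ⟩

theorem isAC_maxl (S : Finset (Finset V)) : IsAC (maxl S) := by
  intro X hX Y hY hXY
  by_contra hne
  exact (Finset.mem_filter.1 hX).2 Y (Finset.mem_filter.1 hY).1 (hXY.ssubset_of_ne hne)

theorem below_acjoin {A B : Finset (Finset V)} {X : Finset V} :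
    Below (acjoin A B) X ↔ Below A X ∨ Below B X := by
  rw [acjoin, below_maxl]
  simp only [Below, Finset.mem_union, or_and_right, exists_or]

theorem below_acmeet {A B : Finset (Finset V)} {X : Finset V} :
    Below (acmeet A B) X ↔ Below A X ∧ Below B X := by
  rw [acmeet, below_maxl]
  constructor
  · rintro ⟨Y, hY, hXY⟩
    obtain ⟨⟨C, D⟩, hCD, rfl⟩ := Finset.mem_image.1 hY
    obtain ⟨hC, hD⟩ := Finset.mem_product.1 hCD
    exact ⟨⟨C, hC, hXY.trans Finset.inter_subset_left⟩,
      ⟨D, hD, hXY.trans Finset.inter_subset_right⟩⟩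
  · rintro ⟨⟨C, hC, hXC⟩, ⟨D, hD, hXD⟩⟩
    exact ⟨C ∩ D, Finset.mem_image.2 ⟨(C, D), Finset.mem_product.2 ⟨hC, hD⟩, rfl⟩,
      Finset.subset_inter hXC hXD⟩

theorem IsAC.subset_of_below_iff {V : Type*} {A B : Finset (Finset V)} (hA : IsAC A)
    (h : ∀ X, Below A X ↔ Below B X) : A ⊆ B := by
  intro X hX
  obtain ⟨Y, hY, hXY⟩ := (h X).1 ⟨X, hX, subset_rfl⟩
  obtain ⟨Z, hZ, hYZ⟩ := (h Y).2 ⟨Y, hY, subset_rfl⟩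
  obtain rfl := hA X hX Z hZ (hXY.trans hYZ)
  rwa [hXY.antisymm hYZ]

/-- An antichain is determined by the down-set it generates. -/
theorem IsAC.ext_below {V : Type*} {A B : Finset (Finset V)} (hA : IsAC A) (hB : IsAC B)
    (h : ∀ X, Below A X ↔ Below B X) : A = B :=
  (hA.subset_of_below_iff h).antisymm (hB.subset_of_below_iff fun X => (h X).symm)

/-- The join of `[l₁, u₁]` and `[l₂, u₂]` is direct and equal to `[a, b]` as soon as, in terms of
down-sets, `a = l₁ ∨ l₂`, `b = u₁ ∨ u₂`, and `u₁ ∧ u₂` lies below both `l₁` and `l₂`. -/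
theorem memI_iff_existsUnique_acjoin {a b l₁ u₁ l₂ u₂ : Finset (Finset V)}
    (h₁ : ∀ X, Below l₁ X → Below u₁ X) (h₂ : ∀ X, Below l₂ X → Below u₂ X)
    (ha : ∀ X, Below a X ↔ Below l₁ X ∨ Below l₂ X)
    (hb : ∀ X, Below b X ↔ Below u₁ X ∨ Below u₂ X)
    (hu : ∀ X, Below u₁ X → Below u₂ X → Below l₁ X ∧ Below l₂ X)
    (χ : Finset (Finset V)) :
    memI a b χ ↔ ∃! p : Finset (Finset V) × Finset (Finset V),
      memI l₁ u₁ p.1 ∧ memI l₂ u₂ p.2 ∧ χ = acjoin p.1 p.2 := by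
  simp only [memI, acle_iff]
  constructor
  · rintro ⟨hχ, haχ, hχb⟩
    refine ⟨(acjoin l₁ (acmeet χ u₁), acjoin l₂ (acmeet χ u₂)),
      ⟨⟨isAC_maxl _, ?_, ?_⟩, ⟨isAC_maxl _, ?_, ?_⟩, hχ.ext_below (isAC_maxl _) ?_⟩, ?_⟩
    · intro X
      simp only [below_acjoin]
      tauto
    · intro X
      have := h₁ X
      simp only [below_acjoin, below_acmeet]
      tauto
    · intro X
      simp only [below_acjoin]
      tauto
    · intro X
      have := h₂ X
      simp only [below_acjoin, below_acmeet]
      tauto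
    · intro X
      have := ha X
      have := hb X
      have := haχ X
      have := hχb X
      simp only [below_acjoin, below_acmeet]
      tauto
    · rintro ⟨p, q⟩ ⟨⟨hp, hlp, hpu⟩, ⟨hq, hlq, hqu⟩, rfl⟩
      refine Prod.ext (hp.ext_below (isAC_maxl _) fun X => ?_)
        (hq.ext_below (isAC_maxl _) fun X => ?_) <;>
      · have := hlp X
        have := hpu X
        have := hlq X
        have := hqu X
        have := hu X
        simp only [below_acjoin, below_acmeet]
        tauto
  · rintro ⟨⟨p, q⟩, ⟨⟨-, hlp, hpu⟩, ⟨-, hlq, hqu⟩, rfl⟩, -⟩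
    refine ⟨isAC_maxl _, fun X => ?_, fun X => ?_⟩
    · rw [ha, below_acjoin]
      exact Or.imp (hlp X) (hlq X)
    · rw [hb, below_acjoin]
      exact Or.imp (hpu X) (hqu X)

/-- Lemma 7 of the paper.  Associate to the interval `[a, b]` the
graph on vertex set `b` in which `A, B ∈ b` are adjacent iff `{A ∩ B} ≰ a`.  If
`b = ν₁ ∪ ν₂` and no edge of this graph joins a member of `ν₁` to a member of `ν₂`
(i.e. `{A ∩ B} ≤ a` for all `A ∈ ν₁`, `B ∈ ν₂`), then
`[a, b] = [a, a ∨ ν₁] ∨ [a, a ∨ ν₂] = [a ∧ ν₁, ν₁] ∨ [a ∧ ν₂, ν₂]`,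
and both joins of intervals are direct. -/
theorem statement6 {V : Type*} [DecidableEq V] [Fintype V]
    (a b ν₁ ν₂ : Finset (Finset V)) (ha : IsAC a) (hb : IsAC b) (hab : acle a b)
    (hsplit : b = ν₁ ∪ ν₂)
    (hno : ∀ A ∈ ν₁, ∀ B ∈ ν₂, acle {A ∩ B} a) :
    (∀ χ : Finset (Finset V), memI a b χ ↔
      ∃! p : Finset (Finset V) × Finset (Finset V),
        memI a (acjoin a ν₁) p.1 ∧ memI a (acjoin a ν₂) p.2 ∧ χ = acjoin p.1 p.2) ∧
    (∀ χ : Finset (Finset V), memI a b χ ↔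
      ∃! p : Finset (Finset V) × Finset (Finset V),
        memI (acmeet a ν₁) ν₁ p.1 ∧ memI (acmeet a ν₂) ν₂ p.2 ∧ χ = acjoin p.1 p.2) := by
  have hν : ∀ X, Below b X ↔ Below ν₁ X ∨ Below ν₂ X := fun X => by
    simp only [hsplit, Below, Finset.mem_union, or_and_right, exists_or]
  have hdisj : ∀ X, Below ν₁ X → Below ν₂ X → Below a X := by
    rintro X ⟨A, hA, hXA⟩ ⟨B, hB, hXB⟩
    exact acle_iff.1 (hno A hA B hB) X
      ⟨A ∩ B, Finset.mem_singleton_self _, Finset.subset_inter hXA hXB⟩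
  rw [acle_iff] at hab
  constructor <;> refine memI_iff_existsUnique_acjoin ?_ ?_ ?_ ?_ ?_ <;> intro X <;>
  · have := hν X
    have := hdisj X
    have := hab X
    try simp only [below_acjoin, below_acmeet]
    tauto

end Antichains
end

section
/- Let N be a finite set partitioned as N = N₁ ∪ N₂ (N₁, N₂ disjoint and nonempty unions allowed), and let α₁ ∈ A_{N₁}, α₂ ∈ A_{N₂} be nonempty antichains. Define S_{α₁,α₂} = {A₁ ∪ A₂ | ∅ ⊊ A₁ ⊆ N₁, ∅ ⊊ A₂ ⊆ N₂, {A₁} ≤ α₁, {A₂} ≤ α₂}. Then S_{α₁,α₂} is an interval poset, and the interval it spans is [α₁ ∨ α₂, α₁ ⊗ α₂]. -/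
/-!
Antichains of subsets of a finite universe
(following De Causmaecker & De Wannemacker,
"On the number of antichains of sets in a finite universe").
-/

open scoped Classical

namespace Antichains

variable {V : Type*} [DecidableEq V]

/-- Direct product of two antichains (with disjoint spans):
`a ⊗ b = {X ∪ Y | X ∈ a, Y ∈ b}`. -/
def dprod (a b : Finset (Finset V)) : Finset (Finset V) :=
  (a ×ˢ b).image fun p => p.1 ∪ p.2

theorem exists_mem_maxl_superset {S : Finset (Finset V)} {X : Finset V} (hX : X ∈ S) :
    ∃ Y ∈ maxl S, X ⊆ Y := by
  obtain ⟨Y, hXY, hY⟩ := S.exists_le_maximal hX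
  refine ⟨Y, Finset.mem_filter.2 ⟨hY.prop, fun Z hZ hYZ => ?_⟩, hXY⟩
  exact hYZ.2 (hY.le_of_ge hZ hYZ.1)

theorem acle_refl (A : Finset (Finset V)) : acle A A :=
  fun X hX => ⟨X, hX, subset_rfl⟩

theorem acle_acjoin_left (A B : Finset (Finset V)) : acle A (acjoin A B) :=
  fun _ hX => exists_mem_maxl_superset (Finset.mem_union_left B hX)

theorem acjoin_acle_iff {A B C : Finset (Finset V)} :
    acle (acjoin A B) C ↔ acle A C ∧ acle B C := by
  constructor
  · intro h
    have key : ∀ X ∈ A ∪ B, ∃ Z ∈ C, X ⊆ Z := by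
      intro X hX
      obtain ⟨Y, hY, hXY⟩ := exists_mem_maxl_superset hX
      obtain ⟨Z, hZ, hYZ⟩ := h Y hY
      exact ⟨Z, hZ, hXY.trans hYZ⟩
    exact ⟨fun X hX => key X (Finset.mem_union_left B hX),
      fun X hX => key X (Finset.mem_union_right A hX)⟩
  · rintro ⟨hA, hB⟩ X hX
    exact (Finset.mem_union.1 (Finset.mem_filter.1 hX).1).elim (hA X) (hB X)

theorem singleton_acle_iff {X : Finset V} {A : Finset (Finset V)} :
    acle {X} A ↔ ∃ Y ∈ A, X ⊆ Y := by
  simp [acle]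

theorem singleton_acle_acjoin_iff {X : Finset V} {A B : Finset (Finset V)} :
    acle {X} (acjoin A B) ↔ acle {X} A ∨ acle {X} B := by
  simp only [singleton_acle_iff]
  constructor
  · rintro ⟨Y, hY, hXY⟩
    exact (Finset.mem_union.1 (Finset.mem_filter.1 hY).1).imp
      (fun h => ⟨Y, h, hXY⟩) (fun h => ⟨Y, h, hXY⟩)
  · rintro (⟨Y, hY, hXY⟩ | ⟨Y, hY, hXY⟩)
    · obtain ⟨Z, hZ, hYZ⟩ := exists_mem_maxl_superset (Finset.mem_union_left B hY)
      exact ⟨Z, hZ, hXY.trans hYZ⟩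
    · obtain ⟨Z, hZ, hYZ⟩ := exists_mem_maxl_superset (Finset.mem_union_right A hY)
      exact ⟨Z, hZ, hXY.trans hYZ⟩

theorem mem_iposet_iff [Fintype V] {a b : Finset (Finset V)} (hab : acle a b) {X : Finset V} :
    X ∈ iposet a b ↔ ¬acle {X} a ∧ acle {X} b := by
  simp only [iposet, aclt, Finset.mem_filter, Finset.mem_univ, true_and, acjoin_acle_iff,
    acle_acjoin_left, acle_refl, hab]

theorem mem_dprod {a b : Finset (Finset V)} {X : Finset V} :
    X ∈ dprod a b ↔ ∃ A ∈ a, ∃ B ∈ b, A ∪ B = X := by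
  simp [dprod, and_assoc]

theorem acjoin_acle_dprod {a b : Finset (Finset V)} (ha : a.Nonempty) (hb : b.Nonempty) :
    acle (acjoin a b) (dprod a b) := by
  obtain ⟨A, hA⟩ := ha
  obtain ⟨B, hB⟩ := hb
  exact acjoin_acle_iff.2
    ⟨fun X hX => ⟨X ∪ B, mem_dprod.2 ⟨X, hX, B, hB, rfl⟩, Finset.subset_union_left⟩,
      fun X hX => ⟨A ∪ X, mem_dprod.2 ⟨A, hA, X, hX, rfl⟩, Finset.subset_union_right⟩⟩

theorem subset_and_subset_of_union_subset_union [Fintype V] {N A B C D : Finset V}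
    (hA : A ⊆ N) (hB : B ⊆ Nᶜ) (hC : C ⊆ N) (hD : D ⊆ Nᶜ) (h : A ∪ B ⊆ C ∪ D) :
    A ⊆ C ∧ B ⊆ D := by
  constructor
  · intro x hx
    refine (Finset.mem_union.1 (h (Finset.mem_union_left B hx))).resolve_right fun hxD => ?_
    exact Finset.mem_compl.1 (hD hxD) (hA hx)
  · intro x hx
    refine (Finset.mem_union.1 (h (Finset.mem_union_right A hx))).resolve_left fun hxC => ?_
    exact Finset.mem_compl.1 (hB hx) (hC hxC)

theorem IsAC.dprod [Fintype V] {N : Finset V} {a b : Finset (Finset V)} (ha : IsAC a)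
    (hb : IsAC b) (haN : ∀ X ∈ a, X ⊆ N) (hbN : ∀ X ∈ b, X ⊆ Nᶜ) : IsAC (dprod a b) := by
  intro X hX Y hY hXY
  obtain ⟨A, hA, B, hB, rfl⟩ := mem_dprod.1 hX
  obtain ⟨C, hC, D, hD, rfl⟩ := mem_dprod.1 hY
  obtain ⟨hAC, hBD⟩ := subset_and_subset_of_union_subset_union
    (haN A hA) (hbN B hB) (haN C hC) (hbN D hD) hXY
  rw [ha A hA C hC hAC, hb B hB D hD hBD]

/-- Lemma 8 of the paper.  Let `{N₁, N₁ᶜ}` be a partition of the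
universe and let `α₁`, `α₂` be nonempty antichains of subsets of `N₁`, resp. `N₁ᶜ`.
Then `S_{α₁,α₂} = {A₁ ∪ A₂ | ∅ ⊊ A₁ ⊆ N₁, ∅ ⊊ A₂ ⊆ N₁ᶜ, {A₁} ≤ α₁, {A₂} ≤ α₂}`
is an interval poset underlying the interval `[α₁ ∨ α₂, α₁ ⊗ α₂]`. -/
theorem statement9 {V : Type*} [DecidableEq V] [Fintype V] (N₁ : Finset V)
    (α₁ α₂ : Finset (Finset V)) (h₁ : IsAC α₁) (h₂ : IsAC α₂)
    (hn₁ : α₁.Nonempty) (hn₂ : α₂.Nonempty)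
    (hs₁ : ∀ X ∈ α₁, X ⊆ N₁) (hs₂ : ∀ X ∈ α₂, X ⊆ N₁ᶜ) :
    (Finset.univ.filter fun Y : Finset V =>
        ∃ A₁ A₂ : Finset V, Y = A₁ ∪ A₂ ∧ A₁.Nonempty ∧ A₁ ⊆ N₁ ∧ acle {A₁} α₁ ∧
          A₂.Nonempty ∧ A₂ ⊆ N₁ᶜ ∧ acle {A₂} α₂) =
      iposet (acjoin α₁ α₂) (dprod α₁ α₂) ∧
    IsAC (acjoin α₁ α₂) ∧ IsAC (dprod α₁ α₂) ∧ acle (acjoin α₁ α₂) (dprod α₁ α₂) := by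
  have hle := acjoin_acle_dprod hn₁ hn₂
  refine ⟨?_, isAC_maxl _, h₁.dprod h₂ hs₁ hs₂, hle⟩
  ext X
  rw [mem_iposet_iff hle, singleton_acle_acjoin_iff, Finset.mem_filter]
  simp only [singleton_acle_iff, Finset.mem_univ, true_and]
  constructor
  · rintro ⟨A₁, A₂, rfl, ⟨x, hx⟩, hA₁, ⟨B₁, hB₁, hAB₁⟩, ⟨y, hy⟩, hA₂, ⟨B₂, hB₂, hAB₂⟩⟩
    refine ⟨?_, B₁ ∪ B₂, mem_dprod.2 ⟨B₁, hB₁, B₂, hB₂, rfl⟩, Finset.union_subset_union hAB₁ hAB₂⟩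
    rintro (⟨C, hC, hXC⟩ | ⟨C, hC, hXC⟩)
    · exact Finset.mem_compl.1 (hA₂ hy) (hs₁ C hC (hXC (Finset.mem_union_right A₁ hy)))
    · exact Finset.mem_compl.1 (hs₂ C hC (hXC (Finset.mem_union_left A₂ hx))) (hA₁ hx)
  · rintro ⟨hX, Y, hY, hXY⟩
    obtain ⟨B₁, hB₁, B₂, hB₂, rfl⟩ := mem_dprod.1 hY
    have hX_eq : X ∩ N₁ ∪ X ∩ N₁ᶜ = X := by
      rw [← Finset.inter_union_distrib_left, Finset.union_compl, Finset.inter_univ]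
    obtain ⟨hXB₁, hXB₂⟩ := subset_and_subset_of_union_subset_union
      (Finset.inter_subset_right (s₁ := X)) (Finset.inter_subset_right (s₁ := X))
      (hs₁ B₁ hB₁) (hs₂ B₂ hB₂) (hX_eq.trans_subset hXY)
    refine ⟨X ∩ N₁, X ∩ N₁ᶜ, hX_eq.symm, ?_, Finset.inter_subset_right, ⟨B₁, hB₁, hXB₁⟩,
      ?_, Finset.inter_subset_right, ⟨B₂, hB₂, hXB₂⟩⟩
    · by_contra hempty
      rw [Finset.not_nonempty_iff_eq_empty] at hempty
      rw [hempty, Finset.empty_union] at hX_eq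
      exact hX (Or.inr ⟨B₂, hB₂, hX_eq ▸ hXB₂⟩)
    · by_contra hempty
      rw [Finset.not_nonempty_iff_eq_empty] at hempty
      rw [hempty, Finset.union_empty] at hX_eq
      exact hX (Or.inl ⟨B₁, hB₁, hX_eq ▸ hXB₁⟩)

end Antichains
end
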